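/- The upper central series of $\widetilde{\mathfrak{n}}(A_3)$, defined by $\mathfrak{n}^0 = 0$ and $\mathfrak{n}^{i+1} = \{x : [x,y] \in \mathfrak{n}^i \text{ for all } y \in \widetilde{\mathfrak{n}}(A_3)\}$, satisfies $\mathfrak{n}^1 = \mathrm{span}\{u_8,\ u_9,\ u_{10}+u_{11},\ u_{12}\}$ of dimension 4 (this is the center), $\mathfrak{n}^2 = \mathrm{span}\{u_6-u_4,\ u_7-u_5,\ u_8,\ u_9,\ u_{10},\ u_{11},\ u_{12}\}$ of dimension 7, and $\mathfrak{n}^3 = \widetilde{\mathfrak{n}}(A_3)$. -/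

import Mathlib

open Fin.NatCast in
/-- The basis vector `u k` (1-based index `k`) of `ℂ^12`. -/
noncomputable def u (k : ℕ) : Fin 12 → ℂ := Pi.single ((k - 1 : ℕ) : Fin 12) 1

/-- Structure constants: `cUp i j` is the value of `[u i, u j]` for `i > j` (1-based). -/
noncomputable def cUp : ℕ → ℕ → (Fin 12 → ℂ)
  | 2, 1 => u 6 - u 4
  | 3, 2 => u 7 - u 5
  | 4, 3 => u 8 - u 10
  | 5, 1 => u 11 - u 8
  | 5, 4 => u 12
  | 6, 3 => u 11 - u 9
  | 7, 1 => u 9 - u 10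
  | 7, 6 => -u 12
  | 10, 2 => -u 12
  | 11, 2 => u 12
  | _, _ => 0

/-- Antisymmetric extension of the structure constants. -/
noncomputable def c (i j : ℕ) : Fin 12 → ℂ :=
  if j < i then cUp i j else if i < j then -cUp j i else 0

/-- The bilinear bracket on `ℂ^12` determined by the structure constants. -/
noncomputable def br (x y : Fin 12 → ℂ) : Fin 12 → ℂ :=
  ∑ i : Fin 12, ∑ j : Fin 12, (x i * y j) • c ((i : ℕ) + 1) ((j : ℕ) + 1)

/-- Upper central series: `ucs 0 = {0}`, `ucs (i+1) = {x | ∀ y, [x, y] ∈ ucs i}`. -/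
noncomputable def ucs : ℕ → Set (Fin 12 → ℂ)
  | 0 => {0}
  | i + 1 => {x | ∀ y, br x y ∈ ucs i}

lemma u_apply (k : ℕ) (i : Fin 12) (hk : 1 ≤ k) (hk' : k ≤ 12) :
    u k i = if (i : ℕ) + 1 = k then 1 else 0 := by
  unfold u
  rw [Pi.single_apply]
  congr 1
  rw [Fin.ext_iff, Fin.val_natCast, Nat.mod_eq_of_lt (by omega)]
  simp only [eq_iff_iff]
  omega

/-- The antisymmetric minor `x_i y_j - x_j y_i` (1-based value handled by the caller). -/
def minor (x y : Fin 12 → ℂ) (i j : Fin 12) : ℂ := x i * y j - x j * y i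

set_option maxRecDepth 10000 in
set_option maxHeartbeats 2000000 in
lemma br_eq (x y : Fin 12 → ℂ) : br x y =
    minor x y 1 0 • (u 6 - u 4) + minor x y 2 1 • (u 7 - u 5) + minor x y 3 2 • (u 8 - u 10)
    + minor x y 4 0 • (u 11 - u 8) + minor x y 4 3 • u 12 + minor x y 5 2 • (u 11 - u 9)
    + minor x y 6 0 • (u 9 - u 10) - minor x y 6 5 • u 12 - minor x y 9 1 • u 12
    + minor x y 10 1 • u 12 := by
  have row (i : Fin 12) : ∑ j : Fin 12, (x i * y j) • c ((i : ℕ) + 1) ((j : ℕ) + 1) =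
      x i • ∑ j : Fin 12, y j • c ((i : ℕ) + 1) ((j : ℕ) + 1) := by
    simp only [Finset.smul_sum, mul_smul]
  unfold br minor
  simp only [row]
  rw [show (Finset.univ : Finset (Fin 12)) = {0, 1, 2, 3, 4, 5, 6, 7, 8, 9, 10, 11} by decide]
  simp [c, cUp]
  module

lemma br_coord (x y : Fin 12 → ℂ) : br x y =
    ![0, 0, 0, -minor x y 1 0, -minor x y 2 1, minor x y 1 0, minor x y 2 1,
      minor x y 3 2 - minor x y 4 0, minor x y 6 0 - minor x y 5 2,
      -minor x y 3 2 - minor x y 6 0, minor x y 4 0 + minor x y 5 2,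
      minor x y 4 3 - minor x y 6 5 - minor x y 9 1 + minor x y 10 1] := by
  rw [br_eq]
  funext k
  fin_cases k <;> simp [u_apply] <;> ring

/-- Spanning family of the centre. -/
noncomputable def v1 : Fin 4 → (Fin 12 → ℂ) := ![u 8, u 9, u 10 + u 11, u 12]

/-- Spanning family of the second term. -/
noncomputable def v2 : Fin 7 → (Fin 12 → ℂ) :=
  ![u 6 - u 4, u 7 - u 5, u 8, u 9, u 10, u 11, u 12]

lemma range_v1 : ({u 8, u 9, u 10 + u 11, u 12} : Set (Fin 12 → ℂ)) = Set.range v1 := by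
  simp only [v1, Matrix.range_cons, Matrix.range_empty, Set.union_empty, Set.singleton_union]

lemma range_v2 : ({u 6 - u 4, u 7 - u 5, u 8, u 9, u 10, u 11, u 12} : Set (Fin 12 → ℂ))
    = Set.range v2 := by
  simp only [v2, Matrix.range_cons, Matrix.range_empty, Set.union_empty, Set.singleton_union]

lemma sum_v1 (a : Fin 4 → ℂ) : ∑ i, a i • v1 i =
    ![0, 0, 0, 0, 0, 0, 0, a 0, a 1, a 2, a 2, a 3] := by
  funext k
  fin_cases k <;> simp [v1, Fin.sum_univ_succ, u_apply]

lemma sum_v2 (a : Fin 7 → ℂ) : ∑ i, a i • v2 i =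
    ![0, 0, 0, -a 0, -a 1, a 0, a 1, a 2, a 3, a 4, a 5, a 6] := by
  funext k
  fin_cases k <;> simp [v2, Fin.sum_univ_succ, u_apply]

lemma mem1 (x : Fin 12 → ℂ) : x ∈ Submodule.span ℂ (Set.range v1) ↔
    x 0 = 0 ∧ x 1 = 0 ∧ x 2 = 0 ∧ x 3 = 0 ∧ x 4 = 0 ∧ x 5 = 0 ∧ x 6 = 0 ∧ x 9 = x 10 := by
  rw [Submodule.mem_span_range_iff_exists_fun]
  constructor
  · rintro ⟨a, rfl⟩
    rw [sum_v1]
    refine ⟨rfl, rfl, rfl, rfl, rfl, rfl, rfl, rfl⟩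
  · rintro ⟨h0, h1, h2, h3, h4, h5, h6, h9⟩
    refine ⟨![x 7, x 8, x 9, x 11], ?_⟩
    rw [sum_v1]
    funext k
    fin_cases k <;> simp [*]

lemma mem2 (x : Fin 12 → ℂ) : x ∈ Submodule.span ℂ (Set.range v2) ↔
    x 0 = 0 ∧ x 1 = 0 ∧ x 2 = 0 ∧ x 3 = -x 5 ∧ x 4 = -x 6 := by
  rw [Submodule.mem_span_range_iff_exists_fun]
  constructor
  · rintro ⟨a, rfl⟩
    rw [sum_v2]
    refine ⟨rfl, rfl, rfl, rfl, rfl⟩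
  · rintro ⟨h0, h1, h2, h3, h4⟩
    refine ⟨![x 5, x 6, x 7, x 8, x 9, x 10, x 11], ?_⟩
    rw [sum_v2]
    funext k
    fin_cases k <;> simp [*]

lemma indep1 : LinearIndependent ℂ v1 := by
  rw [Fintype.linearIndependent_iff]
  intro a h
  rw [sum_v1] at h
  have e (k : Fin 12) := congrFun h k
  intro i
  fin_cases i
  · exact e 7
  · exact e 8
  · exact e 9
  · exact e 11

lemma indep2 : LinearIndependent ℂ v2 := by
  rw [Fintype.linearIndependent_iff]
  intro a h
  rw [sum_v2] at h
  have e (k : Fin 12) := congrFun h k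
  intro i
  fin_cases i
  · exact e 5
  · exact e 6
  · exact e 7
  · exact e 8
  · exact e 9
  · exact e 10
  · exact e 11

lemma ucs_one : ucs 1 = ↑(Submodule.span ℂ (Set.range v1)) := by
  ext x
  rw [SetLike.mem_coe, mem1]
  change (∀ y, br x y = 0) ↔ _
  constructor
  · intro h
    have e (j k : Fin 12) := congrFun (h (Pi.single j 1)) k
    simp only [br_coord] at e
    have a1 := e 0 5
    have a2 := e 1 5
    have a3 := e 1 6
    have a4 := e 2 9
    have a5 := e 0 10
    have a6 := e 2 10
    have a7 := e 0 8
    have a8 := e 1 11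
    simp [minor, Pi.single_apply] at a1 a2 a3 a4 a5 a6 a7 a8
    refine ⟨a2, a1, a3, a4, a5, a6, a7, by linear_combination -a8⟩
  · rintro ⟨h0, h1, h2, h3, h4, h5, h6, h9⟩ y
    rw [br_coord]
    funext k
    fin_cases k <;> simp [minor, *]

lemma ucs_two : ucs 2 = ↑(Submodule.span ℂ (Set.range v2)) := by
  ext x
  rw [SetLike.mem_coe, mem2]
  change (∀ y, br x y ∈ ucs 1) ↔ _
  simp only [ucs_one, SetLike.mem_coe, mem1, br_coord]
  constructor
  · intro h
    obtain ⟨-, -, -, -, -, a1, -, a2⟩ := h (Pi.single 0 1)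
    obtain ⟨-, -, -, -, -, b1, b2, -⟩ := h (Pi.single 1 1)
    obtain ⟨-, -, -, -, -, -, -, c1⟩ := h (Pi.single 2 1)
    simp [minor, Pi.single_apply] at a1 a2 b1 b2 c1
    refine ⟨b1, a1, b2, by linear_combination -c1, by linear_combination -a2⟩
  · rintro ⟨h0, h1, h2, h3, h4⟩ y
    simp [minor, *]
    try ring

lemma ucs_three : ucs 3 = Set.univ := by
  ext x
  change (∀ y, br x y ∈ ucs 2) ↔ _
  simp only [ucs_two, SetLike.mem_coe, mem2, br_coord, Set.mem_univ, iff_true]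
  intro y
  refine ⟨rfl, rfl, rfl, rfl, rfl⟩

theorem stmt_8 :
    ucs 1 = ↑(Submodule.span ℂ ({u 8, u 9, u 10 + u 11, u 12} : Set (Fin 12 → ℂ))) ∧
    Module.finrank ℂ
      ↥(Submodule.span ℂ ({u 8, u 9, u 10 + u 11, u 12} : Set (Fin 12 → ℂ))) = 4 ∧
    ucs 2 = ↑(Submodule.span ℂ
      ({u 6 - u 4, u 7 - u 5, u 8, u 9, u 10, u 11, u 12} : Set (Fin 12 → ℂ))) ∧
    Module.finrank ℂ
      ↥(Submodule.span ℂ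
        ({u 6 - u 4, u 7 - u 5, u 8, u 9, u 10, u 11, u 12} : Set (Fin 12 → ℂ))) = 7 ∧
    ucs 3 = Set.univ := by
  rw [range_v1, range_v2]
  refine ⟨ucs_one, ?_, ucs_two, ?_, ucs_three⟩
  · rw [finrank_span_eq_card indep1, Fintype.card_fin]
  · rw [finrank_span_eq_card indep2, Fintype.card_fin]
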